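/- Let Sp₄(ℤ) = {M ∈ GL₄(ℤ) : MᵀJM = J} with J = [[0, I₂],[−I₂, 0]], let μ₀ : ℤ⁴ → ℤ/2 be μ₀(x₁, x₂, x₃, x₄) = x₁x₃ + x₂x₄ mod 2 (the standard quadratic refinement), and let Sp^q₄(ℤ) = {M ∈ Sp₄(ℤ) : μ₀(M·x) = μ₀(x) for all x ∈ ℤ⁴}. Then the matrix S̃ = [[1,1,−1,−1],[−2,2,1,−1],[2,0,−1,0],[−2,1,1,0]] lies in Sp^q₄(ℤ), and its image in the abelianisation of Sp^q₄(ℤ) has order exactly 4. -/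

import Mathlib

open Matrix

/-- The Gram matrix `J = [[0, I₂], [-I₂, 0]]` of the standard symplectic form on `ℤ⁴`. -/
def J4 : Matrix (Fin 4) (Fin 4) ℤ :=
  !![0, 0, 1, 0; 0, 0, 0, 1; -1, 0, 0, 0; 0, -1, 0, 0]

/-- The standard quadratic refinement `μ₀(x₁, x₂, x₃, x₄) = x₁x₃ + x₂x₄ mod 2`. -/
def mu0 (x : Fin 4 → ℤ) : ZMod 2 := ((x 0 * x 2 + x 1 * x 3 : ℤ) : ZMod 2)

/-- The matrix `S̃`. -/
def Stilde : Matrix (Fin 4) (Fin 4) ℤ :=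
  !![1, 1, -1, -1; -2, 2, 1, -1; 2, 0, -1, 0; -2, 1, 1, 0]

namespace ThetaGroup

/-- The standard symplectic form on `ℤ²`, over an arbitrary commutative ring. -/
def j2 (R : Type*) [CommRing R] : Matrix (Fin 2) (Fin 2) R := !![0, 1; -1, 0]

/-- The Gram matrix of the orthogonal sum of two standard symplectic planes. -/
def blockJ (R : Type*) [CommRing R] : Matrix (Fin 2 ⊕ Fin 2) (Fin 2 ⊕ Fin 2) R :=
  fromBlocks (j2 R) 0 0 (j2 R)

/-- A basis of `ℤ⁴` identifying `H(0) ⊕ H(0)` with `H(1) ⊕ H(1)`. -/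
def basisMat : Matrix (Fin 4) (Fin 2 ⊕ Fin 2) ℤ :=
  fromCols !![0, -1; -1, 0; 1, -1; -1, 0] !![1, 0; 1, 1; 1, 0; 0, 1]

/-- The inverse of `basisMat`. -/
def basisInv : Matrix (Fin 2 ⊕ Fin 2) (Fin 4) ℤ :=
  -(blockJ ℤ * basisMatᵀ * J4)

theorem basisMat_mul_basisInv : basisMat * basisInv = 1 := by
  decide +kernel

theorem basisInv_mul_basisMat : basisInv * basisMat = 1 := by
  decide +kernel

theorem basisMat_transpose_mul_J4_mul : basisMatᵀ * J4 * basisMat = blockJ ℤ := by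
  decide +kernel

/-- The homomorphism `SL₂(ℤ/4) → ℤ/4`, given by a polynomial in the entries. -/
def slChar (A : Matrix (Fin 2) (Fin 2) (ZMod 4)) : ZMod 4 :=
  (1 - A 1 0 ^ 2) * (A 0 1 * A 1 1 + 3 * (A 1 0 - 1) * A 1 1 + A 1 0 + 3) +
    A 1 0 * (A 0 0 + A 1 1 - 3)

theorem slChar_mul {A B : Matrix (Fin 2) (Fin 2) (ZMod 4)} (hA : A.det = 1) (hB : B.det = 1) :
    slChar (A * B) = slChar A + slChar B := by
  have key : ∀ a b c d : ZMod 4, a * d - b * c = 1 → ∀ x y z w : ZMod 4, x * w - y * z = 1 →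
      slChar !![a * x + b * z, a * y + b * w; c * x + d * z, c * y + d * w] =
        slChar !![a, b; c, d] + slChar !![x, y; z, w] := by
    decide +kernel
  rw [det_fin_two] at hA hB
  have h := key _ _ _ _ hA _ _ _ _ hB
  rw [eta_fin_two A, eta_fin_two B, mul_fin_two]
  exact h

/-- Block diagonal modulo 2, with diagonal blocks in `SL₂(ℤ/4)`. -/
def IsDiagMod (N : Matrix (Fin 2 ⊕ Fin 2) (Fin 2 ⊕ Fin 2) (ZMod 4)) : Prop :=
  ∃ A B C D : Matrix (Fin 2) (Fin 2) (ZMod 4), A.det = 1 ∧ D.det = 1 ∧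
    N = fromBlocks A (2 • B) (2 • C) D

/-- Block antidiagonal modulo 2, with antidiagonal blocks in `SL₂(ℤ/4)`. -/
def IsAntiMod (N : Matrix (Fin 2 ⊕ Fin 2) (Fin 2 ⊕ Fin 2) (ZMod 4)) : Prop :=
  ∃ A B C D : Matrix (Fin 2) (Fin 2) (ZMod 4), B.det = 1 ∧ C.det = 1 ∧
    N = fromBlocks (2 • A) B C (2 • D)

/-- The sum of `slChar` over the two blocks which are invertible modulo 2. -/
def blockChar (N : Matrix (Fin 2 ⊕ Fin 2) (Fin 2 ⊕ Fin 2) (ZMod 4)) : ZMod 4 :=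
  if N.toBlocks₁₁.det = 1 then slChar N.toBlocks₁₁ + slChar N.toBlocks₂₂
  else slChar N.toBlocks₁₂ + slChar N.toBlocks₂₁

theorem two_smul_mul_two_smul (A B : Matrix (Fin 2) (Fin 2) (ZMod 4)) :
    (2 • A) * (2 • B) = 0 := by
  rw [smul_mul_smul_comm]
  ext i j
  rw [Matrix.smul_apply, nsmul_eq_mul, Matrix.zero_apply]
  generalize (A * B) i j = x
  revert x
  decide

theorem blockChar_diag {A D : Matrix (Fin 2) (Fin 2) (ZMod 4)} (hA : A.det = 1)
    (B C : Matrix (Fin 2) (Fin 2) (ZMod 4)) :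
    blockChar (fromBlocks A B C D) = slChar A + slChar D := by
  simp [blockChar, hA]

theorem blockChar_anti (A B C D : Matrix (Fin 2) (Fin 2) (ZMod 4)) :
    blockChar (fromBlocks (2 • A) B C D) = slChar B + slChar C := by
  have h : (2 • A).det ≠ 1 := by
    rw [det_fin_two]
    simp only [Matrix.smul_apply, nsmul_eq_mul]
    generalize A 0 0 = a, A 0 1 = b, A 1 0 = c, A 1 1 = d
    revert a b c d
    decide +kernel
  rw [blockChar, toBlocks_fromBlocks₁₁, if_neg h, toBlocks_fromBlocks₁₂, toBlocks_fromBlocks₂₁]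

theorem blockChar_mul {M N : Matrix (Fin 2 ⊕ Fin 2) (Fin 2 ⊕ Fin 2) (ZMod 4)}
    (hM : IsDiagMod M ∨ IsAntiMod M) (hN : IsDiagMod N ∨ IsAntiMod N) :
    blockChar (M * N) = blockChar M + blockChar N := by
  rcases hM with ⟨A, B, C, D, h₁, h₂, rfl⟩ | ⟨A, B, C, D, h₁, h₂, rfl⟩ <;>
  rcases hN with ⟨A', B', C', D', h₁', h₂', rfl⟩ | ⟨A', B', C', D', h₁', h₂', rfl⟩ <;>
  simp only [fromBlocks_multiply, two_smul_mul_two_smul, add_zero, zero_add]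
  · rw [blockChar_diag (by rw [det_mul, h₁, h₁', one_mul]), blockChar_diag h₁, blockChar_diag h₁',
      slChar_mul h₁ h₁', slChar_mul h₂ h₂']
    ring
  · rw [mul_smul_comm, smul_mul_assoc, ← smul_add, blockChar_anti, blockChar_diag h₁,
      blockChar_anti, slChar_mul h₁ h₁', slChar_mul h₂ h₂']
    ring
  · rw [mul_smul_comm, smul_mul_assoc, ← smul_add, blockChar_anti, blockChar_diag h₁',
      blockChar_anti, slChar_mul h₁ h₂', slChar_mul h₂ h₁']
    ring
  · rw [blockChar_diag (by rw [det_mul, h₁, h₂', one_mul]), blockChar_anti, blockChar_anti,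
      slChar_mul h₁ h₂', slChar_mul h₂ h₁']
    ring

/-- Two copies of the quadratic form of Arf invariant one. -/
def arfSum (a b c d : ZMod 2) : ZMod 2 := a * a + a * b + b * b + (c * c + c * d + d * d)

theorem mu0_basisMat_mulVec (y : Fin 2 ⊕ Fin 2 → ℤ) :
    mu0 (basisMat *ᵥ y) = arfSum (y (.inl 0)) (y (.inl 1)) (y (.inr 0)) (y (.inr 1)) := by
  simp only [mu0, basisMat, mulVec, dotProduct, Fintype.sum_sum_type, Fin.sum_univ_two,
    fromCols_apply_inl, fromCols_apply_inr]
  simp only [of_apply, cons_val', cons_val_zero, cons_val_one, cons_val, Int.cast_add,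
    Int.cast_mul, Int.cast_neg, Int.cast_one, Int.cast_zero]
  generalize (y (.inl 0) : ZMod 2) = a, (y (.inl 1) : ZMod 2) = b, (y (.inr 0) : ZMod 2) = c,
    (y (.inr 1) : ZMod 2) = d
  revert a b c d
  decide +kernel

set_option synthInstance.maxSize 2000 in
theorem arfSum_distinct_blocks : ∀ a b c d : ZMod 2, arfSum a b c d = 1 →
    ∀ x y z w : ZMod 2, arfSum x y z w = 1 → arfSum (a + x) (b + y) (c + z) (d + w) = 1 →
    ∀ p q r s : ZMod 2, arfSum p q r s = 1 → arfSum (a + p) (b + q) (c + r) (d + s) = 0 →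
    arfSum (x + p) (y + q) (z + r) (w + s) = 0 →
    (a = 0 ∧ b = 0 ∧ x = 0 ∧ y = 0 ∧ r = 0 ∧ s = 0 ∧ ¬(c = 0 ∧ d = 0)) ∨
    (c = 0 ∧ d = 0 ∧ z = 0 ∧ w = 0 ∧ p = 0 ∧ q = 0 ∧ ¬(a = 0 ∧ b = 0)) := by
  decide +kernel

theorem exists_two_smul {X : Matrix (Fin 2) (Fin 2) ℤ} (h : ∀ i j, (X i j : ZMod 2) = 0) :
    ∃ Y : Matrix (Fin 2) (Fin 2) (ZMod 4), X.map (Int.castRingHom (ZMod 4)) = 2 • Y := by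
  choose f hf using fun i j => (ZMod.intCast_zmod_eq_zero_iff_dvd (X i j) 2).mp (h i j)
  refine ⟨of fun i j => (f i j : ZMod 4), ?_⟩
  ext i j
  simp [hf]

theorem even_blocks {N : Matrix (Fin 2 ⊕ Fin 2) (Fin 2 ⊕ Fin 2) ℤ}
    (h : ∀ y, mu0 (basisMat *ᵥ (N *ᵥ y)) = mu0 (basisMat *ᵥ y)) :
    ((∀ i j, (N.toBlocks₁₂ i j : ZMod 2) = 0) ∧ ∀ i j, (N.toBlocks₂₁ i j : ZMod 2) = 0) ∨
    ((∀ i j, (N.toBlocks₁₁ i j : ZMod 2) = 0) ∧ ∀ i j, (N.toBlocks₂₂ i j : ZMod 2) = 0) := by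
  have e := fun i => h (Pi.single i 1)
  have e₂ := fun i k => h (Pi.single i 1 + Pi.single k 1)
  simp only [mu0_basisMat_mulVec] at e e₂
  simp only [mulVec_add, mulVec_single_one, Pi.add_apply, col_apply, Int.cast_add] at e e₂
  have a₀ := e (.inl 0)
  have a₁ := e (.inl 1)
  have b₀ := e (.inr 0)
  have b₁ := e (.inr 1)
  have a := e₂ (.inl 0) (.inl 1)
  have c₀₀ := e₂ (.inl 0) (.inr 0)
  have c₀₁ := e₂ (.inl 0) (.inr 1)
  have c₁₀ := e₂ (.inl 1) (.inr 0)
  have c₁₁ := e₂ (.inl 1) (.inr 1)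
  have h₀ := arfSum_distinct_blocks _ _ _ _ (a₀.trans (by decide)) _ _ _ _ (a₁.trans (by decide))
    (a.trans (by decide)) _ _ _ _ (b₀.trans (by decide)) (c₀₀.trans (by decide))
    (c₁₀.trans (by decide))
  have h₁ := arfSum_distinct_blocks _ _ _ _ (a₀.trans (by decide)) _ _ _ _ (a₁.trans (by decide))
    (a.trans (by decide)) _ _ _ _ (b₁.trans (by decide)) (c₀₁.trans (by decide))
    (c₁₁.trans (by decide))
  have t₁₁ : ∀ i j, N.toBlocks₁₁ i j = N (.inl i) (.inl j) := fun _ _ => rfl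
  have t₁₂ : ∀ i j, N.toBlocks₁₂ i j = N (.inl i) (.inr j) := fun _ _ => rfl
  have t₂₁ : ∀ i j, N.toBlocks₂₁ i j = N (.inr i) (.inl j) := fun _ _ => rfl
  have t₂₂ : ∀ i j, N.toBlocks₂₂ i j = N (.inr i) (.inr j) := fun _ _ => rfl
  simp only [Fin.forall_fin_two, t₁₁, t₁₂, t₂₁, t₂₂]
  rcases h₀ with ⟨p₀, p₁, p₂, p₃, p₄, p₅, p₆⟩ | ⟨p₀, p₁, p₂, p₃, p₄, p₅, p₆⟩ <;>
  rcases h₁ with ⟨q₀, q₁, q₂, q₃, q₄, q₅, q₆⟩ | ⟨q₀, q₁, q₂, q₃, q₄, q₅, q₆⟩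
  · exact .inr ⟨⟨⟨p₀, p₂⟩, p₁, p₃⟩, ⟨p₄, q₄⟩, p₅, q₅⟩
  · exact absurd ⟨q₀, q₁⟩ p₆
  · exact absurd ⟨q₀, q₁⟩ p₆
  · exact .inl ⟨⟨⟨p₄, q₄⟩, p₅, q₅⟩, ⟨p₀, p₂⟩, p₁, p₃⟩

theorem det_eq_one_of_even {A C : Matrix (Fin 2) (Fin 2) (ZMod 4)}
    (h : Aᵀ * j2 (ZMod 4) * A + (2 • C)ᵀ * j2 (ZMod 4) * (2 • C) = j2 (ZMod 4)) : A.det = 1 := by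
  rw [transpose_smul, smul_mul_assoc, two_smul_mul_two_smul, add_zero] at h
  have h₀ := congrFun (congrFun h 0) 1
  simp [j2, mul_apply, Fin.sum_univ_two] at h₀
  rw [det_fin_two]
  linear_combination h₀

theorem isDiagMod_or_isAntiMod {N : Matrix (Fin 2 ⊕ Fin 2) (Fin 2 ⊕ Fin 2) ℤ}
    (hJ : Nᵀ * blockJ ℤ * N = blockJ ℤ)
    (h : ∀ y, mu0 (basisMat *ᵥ (N *ᵥ y)) = mu0 (basisMat *ᵥ y)) :
    IsDiagMod (N.map (Int.castRingHom (ZMod 4))) ∨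
      IsAntiMod (N.map (Int.castRingHom (ZMod 4))) := by
  have hJ' := congrArg (fun X => X.map (Int.castRingHom (ZMod 4))) hJ
  have hj : (blockJ ℤ).map (Int.castRingHom (ZMod 4)) = blockJ (ZMod 4) := by decide +kernel
  simp only [Matrix.map_mul, transpose_map, hj] at hJ'
  have hN : N.map (Int.castRingHom (ZMod 4)) = fromBlocks
      (N.toBlocks₁₁.map (Int.castRingHom (ZMod 4))) (N.toBlocks₁₂.map (Int.castRingHom (ZMod 4)))
      (N.toBlocks₂₁.map (Int.castRingHom (ZMod 4)))
      (N.toBlocks₂₂.map (Int.castRingHom (ZMod 4))) := by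
    rw [← fromBlocks_map, fromBlocks_toBlocks]
  rw [hN] at hJ' ⊢
  simp only [blockJ, fromBlocks_transpose, fromBlocks_multiply, fromBlocks_inj, mul_zero, zero_add,
    add_zero] at hJ'
  obtain ⟨h₁, -, -, h₂⟩ := hJ'
  rcases even_blocks h with ⟨hX, hY⟩ | ⟨hX, hY⟩ <;>
  obtain ⟨X, hX⟩ := exists_two_smul hX <;>
  obtain ⟨Y, hY⟩ := exists_two_smul hY <;>
  simp only [hX, hY] at h₁ h₂ ⊢
  · rw [add_comm] at h₂
    exact .inl ⟨_, X, Y, _, det_eq_one_of_even h₁, det_eq_one_of_even h₂, rfl⟩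
  · rw [add_comm] at h₁
    exact .inr ⟨X, _, _, Y, det_eq_one_of_even h₂, det_eq_one_of_even h₁, rfl⟩

/-- The matrix of `M` in the basis `basisMat`. -/
def conj (M : Matrix (Fin 4) (Fin 4) ℤ) : Matrix (Fin 2 ⊕ Fin 2) (Fin 2 ⊕ Fin 2) ℤ :=
  basisInv * M * basisMat

theorem basisMat_mul_conj (M : Matrix (Fin 4) (Fin 4) ℤ) : basisMat * conj M = M * basisMat := by
  rw [conj, ← Matrix.mul_assoc, ← Matrix.mul_assoc, basisMat_mul_basisInv, Matrix.one_mul]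

theorem conj_mul (M N : Matrix (Fin 4) (Fin 4) ℤ) : conj (M * N) = conj M * conj N := by
  conv_rhs => rw [conj, Matrix.mul_assoc, basisMat_mul_conj]
  simp only [conj, Matrix.mul_assoc]

theorem conj_isDiagMod_or_isAntiMod {M : Matrix (Fin 4) (Fin 4) ℤ} (hJ : Mᵀ * J4 * M = J4)
    (h : ∀ x, mu0 (M *ᵥ x) = mu0 x) :
    IsDiagMod ((conj M).map (Int.castRingHom (ZMod 4))) ∨
      IsAntiMod ((conj M).map (Int.castRingHom (ZMod 4))) := by
  refine isDiagMod_or_isAntiMod ?_ fun y => ?_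
  · calc (conj M)ᵀ * blockJ ℤ * conj M
        = (basisMat * conj M)ᵀ * J4 * (basisMat * conj M) := by
          rw [← basisMat_transpose_mul_J4_mul, transpose_mul]
          simp only [Matrix.mul_assoc]
      _ = basisMatᵀ * (Mᵀ * J4 * M) * basisMat := by
          rw [basisMat_mul_conj, transpose_mul]
          simp only [Matrix.mul_assoc]
      _ = blockJ ℤ := by rw [hJ, basisMat_transpose_mul_J4_mul]
  · rw [mulVec_mulVec, basisMat_mul_conj, ← mulVec_mulVec, h]

/-- The character `Sp^q₄(ℤ) → ℤ/4`. -/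
def character (M : Matrix (Fin 4) (Fin 4) ℤ) : ZMod 4 :=
  blockChar ((conj M).map (Int.castRingHom (ZMod 4)))

theorem Stilde_mul_Stilde_mul : Stilde * (Stilde * Stilde * Stilde) = 1 := by
  decide +kernel

theorem Stilde_symplectic : Stildeᵀ * J4 * Stilde = J4 := by
  decide +kernel

theorem mu0_Stilde_mulVec (x : Fin 4 → ℤ) : mu0 (Stilde *ᵥ x) = mu0 x := by
  simp only [mu0, Stilde, mulVec, dotProduct, Fin.sum_univ_four]
  simp only [of_apply, cons_val', cons_val_zero, cons_val_one, cons_val, Int.cast_add,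
    Int.cast_mul, Int.cast_neg, Int.cast_one, Int.cast_zero, Int.cast_ofNat]
  generalize (x 0 : ZMod 2) = a, (x 1 : ZMod 2) = b, (x 2 : ZMod 2) = c, (x 3 : ZMod 2) = d
  revert a b c d
  decide +kernel

theorem character_Stilde : character Stilde = 1 := by
  decide +kernel

end ThetaGroup

open ThetaGroup

/-- The matrix `S̃ = [[1,1,-1,-1],[-2,2,1,-1],[2,0,-1,0],[-2,1,1,0]]` lies in `Sp^q₄(ℤ)`, the
subgroup of `Sp₄(ℤ)` preserving the standard quadratic refinement `μ₀`, and its image in the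
abelianisation of `Sp^q₄(ℤ)` has order exactly 4. -/
theorem Stilde_order_four_in_abelianization
    (H : Subgroup (Matrix.GeneralLinearGroup (Fin 4) ℤ))
    (hH : ∀ M : Matrix.GeneralLinearGroup (Fin 4) ℤ,
      M ∈ H ↔ ((M : Matrix (Fin 4) (Fin 4) ℤ)ᵀ * J4 * (M : Matrix (Fin 4) (Fin 4) ℤ) = J4 ∧
        ∀ x : Fin 4 → ℤ, mu0 ((M : Matrix (Fin 4) (Fin 4) ℤ).mulVec x) = mu0 x)) :
    ∃ N : H, ((N : Matrix.GeneralLinearGroup (Fin 4) ℤ) : Matrix (Fin 4) (Fin 4) ℤ) = Stilde ∧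
      orderOf (Abelianization.of N) = 4 := by
  have hinv : (Stilde * Stilde * Stilde) * Stilde = 1 := by
    rw [Matrix.mul_assoc, Matrix.mul_assoc, ← Matrix.mul_assoc Stilde Stilde Stilde]
    exact Stilde_mul_Stilde_mul
  obtain ⟨N, hN⟩ : ∃ N : H,
      ((N : Matrix.GeneralLinearGroup (Fin 4) ℤ) : Matrix (Fin 4) (Fin 4) ℤ) = Stilde :=
    ⟨⟨⟨Stilde, Stilde * Stilde * Stilde, Stilde_mul_Stilde_mul, hinv⟩,
      (hH _).mpr ⟨Stilde_symplectic, mu0_Stilde_mulVec⟩⟩, rfl⟩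
  refine ⟨N, hN, ?_⟩
  let f : H →* Multiplicative (ZMod 4) := MonoidHom.mk'
    (fun M => .ofAdd (character ((M : Matrix.GeneralLinearGroup (Fin 4) ℤ) :
      Matrix (Fin 4) (Fin 4) ℤ))) fun M M' => by
        obtain ⟨h₁, h₂⟩ := (hH M).mp M.2
        obtain ⟨h₁', h₂'⟩ := (hH M').mp M'.2
        rw [← ofAdd_add]
        refine congrArg Multiplicative.ofAdd ?_
        rw [Subgroup.coe_mul, Units.val_mul, character, conj_mul, Matrix.map_mul]
        exact blockChar_mul (conj_isDiagMod_or_isAntiMod h₁ h₂)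
          (conj_isDiagMod_or_isAntiMod h₁' h₂')
  have hpow : N ^ 4 = 1 := by
    refine Subtype.ext (Units.ext ?_)
    rw [Subgroup.coe_pow, Units.val_pow_eq_pow_val, hN, pow_succ, pow_three', hinv]
    rfl
  have hsq : Abelianization.of N ^ 2 ≠ 1 := by
    intro h
    have hf := congrArg (Abelianization.lift f) h
    have hfN : f N = .ofAdd (character Stilde) := by rw [← hN]; rfl
    rw [map_pow, Abelianization.lift_apply_of, map_one, hfN, character_Stilde] at hf
    exact absurd hf (by decide)
  exact orderOf_eq_prime_pow (p := 2) (n := 1) hsq (by rw [← map_pow]; norm_num [hpow])
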